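/- arXiv:2001.00687 — 2 statements merged into one kernel-verified Lean document; each statement's English description precedes it below -/
import Mathlib

section
/- Let A_1, …, A_k ∈ M_n(ℂ) be accretive matrices with 0 < m·I_n ≤ Re(A_i) ≤ M·I_n for all i, where 0 < m ≤ M and h = M/m. Then for every normalized positive multilinear map Φ : M_n(ℂ)^k → M_l(ℂ), one has Φ(Re(A_1^{-1}), …, Re(A_k^{-1})) ≤ K(h^k) · (Φ(Re A_1, …, Re A_k))^{-1} in the Loewner order. -/
open Matrix
open scoped ComplexOrder

/-- The real (Hermitian) part of a complex matrix: `Re A = (A + Aᴴ)/2`. -/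
noncomputable def matRe {n : ℕ} (A : Matrix (Fin n) (Fin n) ℂ) : Matrix (Fin n) (Fin n) ℂ :=
  (2⁻¹ : ℂ) • (A + Aᴴ)

/-- `A` is a sector matrix of angle `α`: its numerical range is contained in
`S_α = {z : Re z > 0, |Im z| ≤ tan α · Re z}`. -/
def InSector {n : ℕ} (α : ℝ) (A : Matrix (Fin n) (Fin n) ℂ) : Prop :=
  ∀ x : Fin n → ℂ, star x ⬝ᵥ x = 1 →
    0 < (star x ⬝ᵥ A *ᵥ x).re ∧
      |(star x ⬝ᵥ A *ᵥ x).im| ≤ Real.tan α * (star x ⬝ᵥ A *ᵥ x).re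

/-- The Kantorovich constant `K(x) = (x+1)²/(4x)`. -/
noncomputable def kant (x : ℝ) : ℝ := (x + 1) ^ 2 / (4 * x)

lemma aux_spec {n : ℕ} {B : Matrix (Fin n) (Fin n) ℂ} (hB : B.PosDef) {m M : ℝ}
    (h1 : (B - m • 1).PosSemidef)
    (h2 : (M • (1 : Matrix (Fin n) (Fin n) ℂ) - B).PosSemidef) :
    ∃ (e : Fin n → ℝ) (P : Fin n → Matrix (Fin n) (Fin n) ℂ),
      (∀ j, m ≤ e j ∧ e j ≤ M) ∧ (∀ j, (P j).PosSemidef) ∧ ∑ j, P j = 1 ∧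
      B = ∑ j, (e j : ℂ) • P j ∧ B⁻¹ = ∑ j, ((e j)⁻¹ : ℂ) • P j := by
  have hH := hB.1
  set U : Matrix (Fin n) (Fin n) ℂ := (hH.eigenvectorUnitary : Matrix (Fin n) (Fin n) ℂ) with hU
  have hUU : U * star U = 1 := Unitary.coe_mul_star_self _
  have hUU' : star U * U = 1 := Unitary.coe_star_mul_self _
  have hpos : ∀ j, 0 < hH.eigenvalues j := fun j => hB.eigenvalues_pos j
  have key : ∀ f : Fin n → ℂ, ∑ j, f j • (U * Matrix.single j j 1 * star U)
      = U * Matrix.diagonal f * star U := by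
    intro f
    have : Matrix.diagonal f = ∑ j, f j • Matrix.single j j (1:ℂ) := by
      rw [← Matrix.sum_single_eq_diagonal]
      simp [Matrix.smul_single]
    rw [this, Finset.mul_sum, Finset.sum_mul]
    refine Finset.sum_congr rfl fun j _ => ?_
    rw [Matrix.mul_smul, Matrix.smul_mul]
  have hBU : B = U * Matrix.diagonal (fun j => (hH.eigenvalues j : ℂ)) * star U := by
    have := hH.spectral_theorem
    rw [Unitary.conjStarAlgAut_apply] at this
    exact this
  have hdiag : star U * B * U = Matrix.diagonal (fun j => (hH.eigenvalues j : ℂ)) := by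
    conv_lhs => rw [hBU]
    calc _ = (star U * U) * Matrix.diagonal (fun j => (hH.eigenvalues j : ℂ)) * (star U * U) := by
          simp only [Matrix.mul_assoc]
      _ = _ := by rw [hUU']; simp
  refine ⟨hH.eigenvalues, fun j => U * Matrix.single j j 1 * star U, ?_, ?_, ?_, ?_, ?_⟩
  · intro j
    have a1 := h1.conjTranspose_mul_mul_same U
    have a2 := h2.conjTranspose_mul_mul_same U
    rw [← Matrix.star_eq_conjTranspose] at a1 a2
    have b1 := a1.diag_nonneg (i := j)
    have b2 := a2.diag_nonneg (i := j)
    simp only [Matrix.mul_sub, Matrix.sub_mul, hdiag, Matrix.mul_smul, Matrix.smul_mul,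
      Matrix.mul_one, hUU'] at b1 b2
    simp at b1 b2
    exact ⟨by exact_mod_cast b1, by exact_mod_cast b2⟩
  · intro j
    have : (Matrix.single j j (1:ℂ)).PosSemidef := by
      rw [← Matrix.diagonal_single]
      apply Matrix.PosSemidef.diagonal
      intro i
      by_cases h : i = j
      · subst h; simp
      · simp [h]
    exact this.mul_mul_conjTranspose_same U
  · have := key (fun _ => 1)
    simpa [hUU] using this
  · rw [key]; exact hBU
  · rw [key]
    apply Matrix.inv_eq_right_inv
    refine (congrArg (· * (U * Matrix.diagonal (fun j => ((hH.eigenvalues j)⁻¹ : ℂ)) * star U))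
      hBU).trans ?_
    calc _ = U * Matrix.diagonal (fun j => (hH.eigenvalues j : ℂ)) * (star U * U) *
          Matrix.diagonal (fun j => ((hH.eigenvalues j)⁻¹ : ℂ)) * star U := by
          simp only [Matrix.mul_assoc]
      _ = U * (Matrix.diagonal (fun j => (hH.eigenvalues j : ℂ)) *
          Matrix.diagonal (fun j => ((hH.eigenvalues j)⁻¹ : ℂ))) * star U := by
          rw [hUU']; simp only [Matrix.mul_assoc, Matrix.one_mul]
      _ = 1 := by
          rw [Matrix.diagonal_mul_diagonal]
          have : (fun j => (hH.eigenvalues j : ℂ) * ((hH.eigenvalues j)⁻¹ : ℂ)) = fun _ => 1 := by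
            funext j
            exact mul_inv_cancel₀ (by exact_mod_cast (hpos j).ne')
          rw [this]; simp [hUU]

lemma aux_isUnit {n : ℕ} {A : Matrix (Fin n) (Fin n) ℂ} (hA : (matRe A).PosDef) :
    IsUnit A := by
  rw [← Matrix.mulVec_injective_iff_isUnit]
  refine (injective_iff_map_eq_zero A.mulVecLin).2 ?_
  intro x hx
  by_contra hne
  have := hA.dotProduct_mulVec_pos hne
  have hx' : A *ᵥ x = 0 := hx
  have h3 : star x ⬝ᵥ (Aᴴ *ᵥ x) = 0 := by
    rw [Matrix.dotProduct_mulVec, ← Matrix.star_mulVec, hx']; simp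
  simp [matRe, Matrix.smul_mulVec, Matrix.add_mulVec, hx', h3] at this

lemma aux_inv {n : ℕ} {A : Matrix (Fin n) (Fin n) ℂ} (hA : (matRe A).PosDef) :
    (matRe A⁻¹).PosSemidef ∧ ((matRe A)⁻¹ - matRe A⁻¹).PosSemidef := by
  have hu := aux_isUnit hA
  have hd : IsUnit A.det := (Matrix.isUnit_iff_isUnit_det A).1 hu
  have hdB : IsUnit (matRe A).det := (Matrix.isUnit_iff_isUnit_det _).1 hA.isUnit
  have e1 : A⁻¹ * A = 1 := Matrix.nonsing_inv_mul A hd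
  have e2 : Aᴴ * A⁻¹ᴴ = 1 := by
    rw [← Matrix.conjTranspose_mul, e1]; simp
  have e3 : matRe A⁻¹ = A⁻¹ * matRe A * A⁻¹ᴴ := by
    unfold matRe
    rw [Matrix.mul_smul, Matrix.smul_mul, Matrix.mul_add, Matrix.add_mul, e1,
      Matrix.mul_assoc A⁻¹, e2, Matrix.one_mul, Matrix.mul_one, add_comm]
  refine ⟨e3 ▸ hA.posSemidef.mul_mul_conjTranspose_same _, ?_⟩
  set B := matRe A with hB
  have hBH : Bᴴ = B := hA.1
  have f1 : B * B⁻¹ = 1 := Matrix.mul_nonsing_inv _ hdB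
  have f2 : B⁻¹ * B = 1 := Matrix.nonsing_inv_mul _ hdB
  have hAA : A + Aᴴ = B + B := by
    rw [hB, matRe, ← add_smul]; norm_num
  have hAH : Aᴴ = B + B - A := by rw [← hAA]; abel
  have e4 : B⁻¹ - matRe A⁻¹ = (A⁻¹ * (A - B)) * B⁻¹ * (A⁻¹ * (A - B))ᴴ := by
    rw [e3, Matrix.conjTranspose_mul]
    have g : (A - B) * B⁻¹ * (A - B)ᴴ = A * B⁻¹ * Aᴴ - B := by
      rw [Matrix.conjTranspose_sub, hBH, hAH]
      simp only [Matrix.sub_mul, Matrix.mul_sub, Matrix.mul_add, f1, Matrix.mul_assoc, f2,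
        Matrix.one_mul, Matrix.mul_one]
      abel
    calc B⁻¹ - A⁻¹ * B * A⁻¹ᴴ = (A⁻¹ * A) * B⁻¹ * (Aᴴ * A⁻¹ᴴ) - A⁻¹ * B * A⁻¹ᴴ := by
          rw [e1, e2]; simp
      _ = A⁻¹ * (A * B⁻¹ * Aᴴ - B) * A⁻¹ᴴ := by
          simp only [Matrix.sub_mul, Matrix.mul_sub, Matrix.mul_assoc]
      _ = _ := by rw [← g]; simp only [Matrix.mul_assoc]
  rw [e4]
  exact hA.inv.posSemidef.mul_mul_conjTranspose_same _

lemma aux_mono {n l k : ℕ} 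
    (Φ : MultilinearMap ℂ (fun _ : Fin k => Matrix (Fin n) (Fin n) ℂ)
      (Matrix (Fin l) (Fin l) ℂ))
    (hΦpos : ∀ X : Fin k → Matrix (Fin n) (Fin n) ℂ,
      (∀ i, (X i).PosSemidef) → (Φ X).PosSemidef)
    (X Y : Fin k → Matrix (Fin n) (Fin n) ℂ) (hX : ∀ i, (X i).PosSemidef)
    (hXY : ∀ i, (Y i - X i).PosSemidef) : (Φ Y - Φ X).PosSemidef := by
  classical
  have : Y = X + (Y - X) := by abel
  rw [this, Φ.map_add_univ, ← Finset.add_sum_erase _ _ (Finset.mem_univ Finset.univ)]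
  rw [Finset.piecewise_univ, add_sub_cancel_left]
  apply Matrix.posSemidef_sum
  intro s _
  apply hΦpos
  intro i
  by_cases h : i ∈ s
  · simpa [h] using hX i
  · simpa [h] using hXY i

lemma aux_kant {n l k : ℕ} {B : Fin k → Matrix (Fin n) (Fin n) ℂ}
    (hB : ∀ i, (B i).PosDef)
    {m M : ℝ} (hm : 0 < m)
    (h1 : ∀ i, (B i - m • 1).PosSemidef)
    (h2 : ∀ i, (M • (1 : Matrix (Fin n) (Fin n) ℂ) - B i).PosSemidef)
    (Φ : MultilinearMap ℂ (fun _ : Fin k => Matrix (Fin n) (Fin n) ℂ)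
      (Matrix (Fin l) (Fin l) ℂ))
    (hΦpos : ∀ X : Fin k → Matrix (Fin n) (Fin n) ℂ,
      (∀ i, (X i).PosSemidef) → (Φ X).PosSemidef)
    (hΦ1 : Φ (fun _ => 1) = 1) :
    (Φ B - m ^ k • (1 : Matrix (Fin l) (Fin l) ℂ)).PosSemidef ∧
    ((m ^ k + M ^ k) • (1 : Matrix (Fin l) (Fin l) ℂ) - Φ B
      - (m ^ k * M ^ k) • Φ (fun i => (B i)⁻¹)).PosSemidef := by
  classical
  choose e P he hP hsum hBe hBi using fun i => aux_spec (hB i) (h1 i) (h2 i)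
  have E1 : (1 : Matrix (Fin l) (Fin l) ℂ) = ∑ r : Fin k → Fin n, Φ (fun i => P i (r i)) := by
    rw [← Φ.map_sum (fun i j => P i j), ← hΦ1]
    congr 1; funext i; exact (hsum i).symm
  have E2 : Φ B = ∑ r : Fin k → Fin n, (∏ i, e i (r i)) • Φ (fun i => P i (r i)) := by
    have : B = fun i => ∑ j, (e i j : ℂ) • P i j := by funext i; exact hBe i
    conv_lhs => rw [this]
    rw [Φ.map_sum (fun i j => (e i j : ℂ) • P i j)]
    refine Finset.sum_congr rfl fun r _ => ?_
    rw [Φ.map_smul_univ (fun i => (e i (r i) : ℂ)) (fun i => P i (r i)), ← Complex.ofReal_prod,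
      Complex.coe_smul]
  have E3 : Φ (fun i => (B i)⁻¹)
      = ∑ r : Fin k → Fin n, (∏ i, e i (r i))⁻¹ • Φ (fun i => P i (r i)) := by
    have : (fun i => (B i)⁻¹) = fun i => ∑ j, ((e i j : ℂ)⁻¹) • P i j := by funext i; exact hBi i
    rw [this]
    rw [Φ.map_sum (fun i j => ((e i j : ℂ)⁻¹) • P i j)]
    refine Finset.sum_congr rfl fun r _ => ?_
    rw [Φ.map_smul_univ (fun i => ((e i (r i) : ℂ)⁻¹)) (fun i => P i (r i)),
      Finset.prod_inv_distrib, ← Complex.ofReal_prod, ← Complex.ofReal_inv, Complex.coe_smul]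
  have lo : ∀ r : Fin k → Fin n, m ^ k ≤ ∏ i, e i (r i) := by
    intro r
    have := Finset.prod_le_prod (s := Finset.univ) (f := fun _ : Fin k => m)
      (g := fun i => e i (r i)) (fun _ _ => hm.le) (fun i _ => (he i (r i)).1)
    simpa using this
  have hi : ∀ r : Fin k → Fin n, ∏ i, e i (r i) ≤ M ^ k := by
    intro r
    have := Finset.prod_le_prod (s := Finset.univ) (g := fun _ : Fin k => M)
      (f := fun i => e i (r i)) (fun i _ => hm.le.trans (he i (r i)).1) (fun i _ => (he i (r i)).2)
    simpa using this
  have hmk : 0 < m ^ k := pow_pos hm k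
  constructor
  · rw [E2, E1, Finset.smul_sum, ← Finset.sum_sub_distrib]
    apply Matrix.posSemidef_sum
    intro r _
    rw [← sub_smul]
    exact (hΦpos _ fun i => hP i _).smul (sub_nonneg.2 (lo r))
  · rw [E2, E3, E1, Finset.smul_sum, Finset.smul_sum, ← Finset.sum_sub_distrib,
      ← Finset.sum_sub_distrib]
    apply Matrix.posSemidef_sum
    intro r _
    rw [smul_smul, ← sub_smul, ← sub_smul]
    refine (hΦpos _ fun i => hP i _).smul ?_
    have a := lo r
    have b := hi r
    set t := ∏ i, e i (r i)
    have ht : 0 < t := hmk.trans_le a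
    have : m ^ k + M ^ k - t - m ^ k * M ^ k * t⁻¹ = (t - m ^ k) * (M ^ k - t) / t := by
      field_simp; ring
    rw [this]
    exact div_nonneg (mul_nonneg (sub_nonneg.2 a) (sub_nonneg.2 b)) ht.le

/-- For accretive matrices `A₁, …, A_k` with `0 < m·I ≤ Re(Aᵢ) ≤ M·I`, `h = M/m`, and every
normalized positive multilinear map `Φ`,
`Φ(Re(A₁⁻¹), …, Re(A_k⁻¹)) ≤ K(h^k)·Φ(Re A₁, …, Re A_k)⁻¹` in the Loewner order. -/
theorem stmt16 {n l k : ℕ} {A : Fin k → Matrix (Fin n) (Fin n) ℂ}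
    (hacc : ∀ i, (matRe (A i)).PosDef)
    {m M : ℝ} (hm : 0 < m) (hmM : m ≤ M)
    (h1 : ∀ i, (matRe (A i) - m • 1).PosSemidef)
    (h2 : ∀ i, (M • (1 : Matrix (Fin n) (Fin n) ℂ) - matRe (A i)).PosSemidef)
    (Φ : MultilinearMap ℂ (fun _ : Fin k => Matrix (Fin n) (Fin n) ℂ)
      (Matrix (Fin l) (Fin l) ℂ))
    (hΦpos : ∀ X : Fin k → Matrix (Fin n) (Fin n) ℂ,
      (∀ i, (X i).PosSemidef) → (Φ X).PosSemidef)
    (hΦ1 : Φ (fun _ => 1) = 1) :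
    (kant ((M / m) ^ k) • (Φ (fun i => matRe (A i)))⁻¹ -
      Φ (fun i => matRe ((A i)⁻¹))).PosSemidef := by
  have hmono := aux_mono Φ hΦpos (fun i => matRe (A i)⁻¹) (fun i => (matRe (A i))⁻¹)
    (fun i => (aux_inv (hacc i)).1) (fun i => (aux_inv (hacc i)).2)
  obtain ⟨k1, k2⟩ := aux_kant hacc hm h1 h2 Φ hΦpos hΦ1
  set C := Φ (fun i => matRe (A i)) with hC
  set D := Φ (fun i => (matRe (A i))⁻¹)
  set E := Φ (fun i => matRe (A i)⁻¹)
  have hmk : 0 < m ^ k := pow_pos hm k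
  have hMk : 0 < M ^ k := pow_pos (hm.trans_le hmM) k
  have hCp : C.PosDef := by
    have : (m ^ k • (1 : Matrix (Fin l) (Fin l) ℂ)).PosDef := Matrix.PosDef.one.smul hmk
    simpa using this.add_posSemidef k1
  have hdC : IsUnit C.det := (Matrix.isUnit_iff_isUnit_det _).1 hCp.isUnit
  have f1 : C * C⁻¹ = 1 := Matrix.mul_nonsing_inv _ hdC
  have f2 : C⁻¹ * C = 1 := Matrix.nonsing_inv_mul _ hdC
  have hK : kant ((M / m) ^ k) = (m ^ k * M ^ k)⁻¹ * ((m ^ k + M ^ k) / 2) ^ 2 := by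
    unfold kant
    rw [div_pow]
    generalize m ^ k = a at *
    generalize M ^ k = b at *
    field_simp
    ring
  set s := m ^ k + M ^ k
  set c := m ^ k * M ^ k with hc
  have hcpos : 0 < c := mul_pos hmk hMk
  have hsq : ((s / 2) ^ 2 • C⁻¹ - s • 1 + C).PosSemidef := by
    have hCs : (C - (s / 2) • (1 : Matrix (Fin l) (Fin l) ℂ))ᴴ = C - (s / 2) • 1 := by
      rw [Matrix.conjTranspose_sub, hCp.1, Matrix.conjTranspose_smul]; simp
    have := hCp.inv.posSemidef.mul_mul_conjTranspose_same
      (C - (s / 2) • (1 : Matrix (Fin l) (Fin l) ℂ))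
    rw [hCs] at this
    have heq : (s / 2) ^ 2 • C⁻¹ - s • 1 + C = (C - (s / 2) • (1 : Matrix (Fin l) (Fin l) ℂ)) *
        C⁻¹ * (C - (s / 2) • (1 : Matrix (Fin l) (Fin l) ℂ)) := by
      simp only [Matrix.sub_mul, Matrix.mul_sub, f1, f2, Matrix.smul_mul, Matrix.mul_smul,
        Matrix.one_mul, Matrix.mul_one]
      module
    rw [heq]; exact this
  have hfin : kant ((M / m) ^ k) • C⁻¹ - E
      = c⁻¹ • (((s / 2) ^ 2 • C⁻¹ - s • 1 + C) + (s • 1 - C - c • D)) + (D - E) := by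
    rw [hK, mul_smul]
    have : c⁻¹ • c • D = D := by rw [smul_smul, inv_mul_cancel₀ hcpos.ne', one_smul]
    simp only [smul_add, smul_sub, this]
    abel
  rw [hfin]
  exact ((hsq.add k2).smul (inv_nonneg.2 hcpos.le)).add hmono
end

section
/- Let α ∈ [0, π/2), let A, B ∈ M_n(ℂ) be sector matrices of angle α, let v ∈ [0,1], and let 1 ≤ k ≤ n. Then ∏_{j=1}^{k} s_j(((1-v)A^{-1} + vB^{-1})^{-1}) ≤ sec^{4k}(α) · ∏_{j=1}^{k} s_j((1-v)A + vB); that is, the product of the first k singular values of the weighted harmonic mean A!_vB is at most sec^{4k}(α) times the product of the first k singular values of the weighted arithmetic mean A∇_vB. -/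
open Matrix
open scoped ComplexOrder

/-- The `j`-th largest singular value of `X` (eigenvalues of `(XᴴX)^{1/2}` in
decreasing order): `sval X 0 ≥ sval X 1 ≥ …`. -/
noncomputable def sval {n : ℕ} (X : Matrix (Fin n) (Fin n) ℂ) (j : Fin n) : ℝ :=
  Real.sqrt ((Matrix.posSemidef_conjTranspose_mul_self X).1.eigenvalues
    (Tuple.sort (Matrix.posSemidef_conjTranspose_mul_self X).1.eigenvalues j.rev))

namespace Aux19

variable {n : ℕ}

/-- the sesquilinear form -/
noncomputable def q (A : Matrix (Fin n) (Fin n) ℂ) (x y : Fin n → ℂ) : ℂ := star x ⬝ᵥ A *ᵥ y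

lemma self_re (x : Fin n → ℂ) : star x ⬝ᵥ x = (‖WithLp.toLp 2 x‖ ^ 2 : ℝ) := by
  rw [EuclideanSpace.norm_sq_eq]
  simp only [dotProduct, Pi.star_apply, RCLike.star_def, Complex.conj_mul', Complex.ofReal_sum,
    Complex.ofReal_pow]

lemma sector_all {α : ℝ} {A : Matrix (Fin n) (Fin n) ℂ} (hA : InSector α A)
    (x : Fin n → ℂ) (hx : x ≠ 0) :
    0 < (q A x x).re ∧ |(q A x x).im| ≤ Real.tan α * (q A x x).re := by
  have hr : 0 < ‖WithLp.toLp 2 x‖ := by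
    rw [norm_pos_iff]; intro h; apply hx
    simpa using h
  set r := ‖WithLp.toLp 2 x‖ with hrdef
  have h := hA (((r⁻¹ : ℝ) : ℂ) • x) (by
    rw [star_smul, smul_dotProduct, dotProduct_smul, self_re, ← hrdef]
    simp only [RCLike.star_def, Complex.conj_ofReal, smul_eq_mul]
    norm_cast
    field_simp)
  have e : star (((r⁻¹ : ℝ) : ℂ) • x) ⬝ᵥ A *ᵥ (((r⁻¹ : ℝ) : ℂ) • x)
      = ((r⁻¹ ^ 2 : ℝ) : ℂ) * q A x x := by
    rw [star_smul, smul_dotProduct, mulVec_smul, dotProduct_smul, q]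
    simp only [RCLike.star_def, Complex.conj_ofReal, smul_eq_mul]
    push_cast
    ring
  rw [e, Complex.re_ofReal_mul, Complex.im_ofReal_mul, abs_mul] at h
  have h2 : 0 < r⁻¹ ^ 2 := by positivity
  rw [abs_of_pos h2] at h
  refine ⟨pos_of_mul_pos_right h.1 h2.le, ?_⟩
  have := h.2
  rw [mul_left_comm] at this
  exact le_of_mul_le_mul_left this h2

lemma q_expand (A : Matrix (Fin n) (Fin n) ℂ) (x y : Fin n → ℂ) (μ : ℂ) :
    q A (x - μ • y) (x - μ • y) =
      q A x x + star μ * μ * q A y y - μ * q A x y - star μ * q A y x := by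
  simp only [q, star_sub, star_smul, sub_dotProduct, mulVec_sub, mulVec_smul, dotProduct_sub,
    smul_dotProduct, dotProduct_smul, smul_eq_mul]
  ring

lemma key1 {α : ℝ} {A : Matrix (Fin n) (Fin n) ℂ} (hA : InSector α A)
    (x y : Fin n → ℂ) (s t : ℝ) (ht0 : 0 < t) (ht : Real.tan α ≤ t) :
    2 * s * (q A x y).re ≤ (q A x x).re + s ^ 2 * (1 + t ^ 2) * (q A y y).re := by
  have hs : ∀ z, |(q A z z).im| ≤ t * (q A z z).re := by
    intro z
    by_cases hz : z = 0
    · simp [hz, q]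
    · obtain ⟨h1, h2⟩ := sector_all hA z hz
      nlinarith
  have h1 := (abs_le.1 (hs (x - (⟨s, s * t⟩ : ℂ) • y))).1
  have h2 := (abs_le.1 (hs (x - (⟨s, -(s * t)⟩ : ℂ) • y))).2
  rw [q_expand] at h1 h2
  simp at h1 h2
  have : 0 ≤ t * ((q A x x).re + s ^ 2 * (1 + t ^ 2) * (q A y y).re - 2 * s * (q A x y).re) := by
    nlinarith
  have := nonneg_of_mul_nonneg_right this ht0
  linarith

lemma q_conj (A : Matrix (Fin n) (Fin n) ℂ) (y : Fin n → ℂ) :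
    (star (A *ᵥ y) ⬝ᵥ y).re = (q A y y).re := by
  have : star (A *ᵥ y) ⬝ᵥ y = star (q A y y) := by
    rw [q, star_dotProduct, dotProduct_comm]
  rw [this]; simp

lemma key2 {α : ℝ} (hα : α ∈ Set.Ico 0 (Real.pi / 2))
    {A : Matrix (Fin n) (Fin n) ℂ} (hA : InSector α A) (x : Fin n → ℂ) (hx : x ≠ 0) :
    0 < (q A x x).re ∧ 
    Real.cos α ^ 2 * (‖WithLp.toLp 2 x‖ ^ 2) ^ 2 ≤ (q A x x).re * (q A⁻¹ x x).re := by
  have hc : 0 < Real.cos α := Real.cos_pos_of_mem_Ioo ⟨by linarith [hα.1, Real.pi_pos], hα.2⟩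
  have htan : 0 ≤ Real.tan α := Real.tan_nonneg_of_nonneg_of_le_pi_div_two hα.1 hα.2.le
  refine ⟨(sector_all hA x hx).1, ?_⟩
  have hu : IsUnit A := by
    rw [← mulVec_injective_iff_isUnit]
    refine (injective_iff_map_eq_zero (Matrix.mulVecLin A)).2 fun y hy => ?_
    by_contra h
    have := (sector_all hA y h).1
    have hy' : A *ᵥ y = 0 := hy
    simp [q, hy'] at this
  have hdet := (Matrix.isUnit_iff_isUnit_det A).1 hu
  set y := A⁻¹ *ᵥ x with hy
  have hAy : A *ᵥ y = x := by rw [hy, mulVec_mulVec, mul_nonsing_inv _ hdet, one_mulVec]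
  have hy0 : y ≠ 0 := by
    intro h; rw [h] at hAy; simp at hAy; exact hx hAy.symm
  have ey : (q A⁻¹ x x).re = (q A y y).re := by
    rw [← q_conj A y, hAy, q]
  rw [ey]
  have exy : (q A x y).re = ‖WithLp.toLp 2 x‖ ^ 2 := by
    rw [q, hAy, self_re, Complex.ofReal_re]
  set c := ‖WithLp.toLp 2 x‖ ^ 2
  have ha' := (sector_all hA y hy0).1
  set a := (q A x x).re with ha
  set b := (q A y y).re with hb
  have main : ∀ t, Real.tan α < t → c ^ 2 ≤ (1 + t ^ 2) * (a * b) := by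
    intro t ht
    have h := key1 hA x y (c / ((1 + t ^ 2) * b)) t (by linarith) ht.le
    rw [exy, ← ha, ← hb] at h
    have e1 : 2 * (c / ((1 + t ^ 2) * b)) * c = 2 * (c ^ 2 / ((1 + t ^ 2) * b)) := by ring
    have e2 : (c / ((1 + t ^ 2) * b)) ^ 2 * (1 + t ^ 2) * b = c ^ 2 / ((1 + t ^ 2) * b) := by
      field_simp
    rw [e1, e2] at h
    have h3 : c ^ 2 / ((1 + t ^ 2) * b) ≤ a := by linarith
    rw [div_le_iff₀ (by positivity)] at h3
    linarith
  have lim : c ^ 2 ≤ (1 + Real.tan α ^ 2) * (a * b) := by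
    have hcont : Filter.Tendsto (fun t : ℝ => (1 + t ^ 2) * (a * b))
        (nhdsWithin (Real.tan α) (Set.Ioi (Real.tan α)))
        (nhds ((1 + Real.tan α ^ 2) * (a * b))) :=
      (Continuous.tendsto (by fun_prop) _).mono_left nhdsWithin_le_nhds
    exact ge_of_tendsto hcont (Filter.eventually_of_mem self_mem_nhdsWithin main)
  have e : Real.cos α ^ 2 * (1 + Real.tan α ^ 2) = 1 := by
    rw [Real.tan_eq_sin_div_cos]
    field_simp
    linarith [Real.sin_sq_add_cos_sq α]
  calc Real.cos α ^ 2 * c ^ 2 ≤ Real.cos α ^ 2 * ((1 + Real.tan α ^ 2) * (a * b)) := by gcongr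
    _ = a * b := by rw [← mul_assoc, e, one_mul]

lemma q_comb (A B : Matrix (Fin n) (Fin n) ℂ) (v w : ℝ) (x : Fin n → ℂ) :
    (q (v • A + w • B) x x).re = v * (q A x x).re + w * (q B x x).re := by
  simp only [q, add_mulVec, smul_mulVec, dotProduct_add, dotProduct_smul, Complex.add_re,
    Complex.smul_re, smul_eq_mul]

lemma key3 {α : ℝ} (hα : α ∈ Set.Ico 0 (Real.pi / 2))
    {A B : Matrix (Fin n) (Fin n) ℂ} (hA : InSector α A) (hB : InSector α B)
    {v : ℝ} (hv : v ∈ Set.Icc (0 : ℝ) 1) (x : Fin n → ℂ) (hx : x ≠ 0) :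
    0 < (q ((1 - v) • A + v • B) x x).re ∧
    Real.cos α ^ 2 * (‖WithLp.toLp 2 x‖ ^ 2) ^ 2 ≤
      (q ((1 - v) • A + v • B) x x).re * (q ((1 - v) • A⁻¹ + v • B⁻¹) x x).re := by
  obtain ⟨ha, hA2⟩ := key2 hα hA x hx
  obtain ⟨hb, hB2⟩ := key2 hα hB x hx
  rw [q_comb, q_comb]
  set a := (q A x x).re
  set b := (q B x x).re
  set a' := (q A⁻¹ x x).re
  set b' := (q B⁻¹ x x).re
  set C := Real.cos α ^ 2 * (‖WithLp.toLp 2 x‖ ^ 2) ^ 2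
  obtain ⟨h0, h1⟩ := hv
  have hC : 0 ≤ C := by positivity
  have hw : 0 ≤ 1 - v := by linarith
  constructor
  · rcases eq_or_lt_of_le h0 with h | h
    · rw [← h]; linarith
    · have := mul_pos h hb
      have := mul_nonneg hw ha.le
      linarith
  · have hcross : 2 * C ≤ a * b' + b * a' := by
      have e1 : C / a ≤ a' := by rw [div_le_iff₀ ha]; linarith
      have e2 : C / b ≤ b' := by rw [div_le_iff₀ hb]; linarith
      have e3 : a * (C / b) + b * (C / a) ≤ a * b' + b * a' := by gcongr
      have e4 : a * (C / b) + b * (C / a) - 2 * C = C * (a - b) ^ 2 / (a * b) := by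
        field_simp; ring
      have : 0 ≤ C * (a - b) ^ 2 / (a * b) := by positivity
      linarith
    have i1 := mul_le_mul_of_nonneg_left hA2 (mul_nonneg hw hw)
    have i2 := mul_le_mul_of_nonneg_left hB2 (mul_nonneg h0 h0)
    have i3 := mul_le_mul_of_nonneg_left hcross (mul_nonneg h0 hw)
    nlinarith

lemma sval_nonneg (X : Matrix (Fin n) (Fin n) ℂ) (j : Fin n) : 0 ≤ sval X j := Real.sqrt_nonneg _

lemma sval_anti (X : Matrix (Fin n) (Fin n) ℂ) {i j : Fin n} (h : i ≤ j) :
    sval X j ≤ sval X i := by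
  apply Real.sqrt_le_sqrt
  exact Tuple.monotone_sort (Matrix.posSemidef_conjTranspose_mul_self X).1.eigenvalues
    (Fin.rev_le_rev.2 h)

lemma svd (X : Matrix (Fin n) (Fin n) ℂ) :
    ∃ u : OrthonormalBasis (Fin n) ℂ (EuclideanSpace ℂ (Fin n)), ∀ x : Fin n → ℂ,
      ‖WithLp.toLp 2 (X *ᵥ x)‖ ^ 2 = ∑ i, sval X i ^ 2 * ‖inner ℂ (u i) (WithLp.toLp 2 x)‖ ^ 2 := by
  have hP := Matrix.posSemidef_conjTranspose_mul_self X
  let e : Fin n ≃ Fin n := Fin.revPerm.trans (Tuple.sort hP.1.eigenvalues)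
  refine ⟨hP.1.eigenvectorBasis.reindex e.symm, fun x => ?_⟩
  have hs : ∀ i, sval X i ^ 2 = hP.1.eigenvalues (e i) := fun i =>
    Real.sq_sqrt (hP.eigenvalues_nonneg _)
  simp only [hs, OrthonormalBasis.reindex_apply, Equiv.symm_symm]
  rw [Equiv.sum_comp e (fun i => hP.1.eigenvalues i *
    ‖inner ℂ (hP.1.eigenvectorBasis i) (WithLp.toLp 2 x)‖ ^ 2)]
  have h1 : (((‖WithLp.toLp 2 (X *ᵥ x)‖ ^ 2 : ℝ)) : ℂ)
      = inner ℂ (WithLp.toLp 2 x) (WithLp.toLp 2 ((Xᴴ * X) *ᵥ x)) := by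
    rw [← self_re, EuclideanSpace.inner_toLp_toLp, star_mulVec, ← dotProduct_mulVec,
      mulVec_mulVec, dotProduct_comm]
  have h2 : ∀ i, inner ℂ (hP.1.eigenvectorBasis i) (WithLp.toLp 2 ((Xᴴ * X) *ᵥ x))
      = hP.1.eigenvalues i * inner ℂ (hP.1.eigenvectorBasis i) (WithLp.toLp 2 x) := by
    intro i
    have hv := hP.1.mulVec_eigenvectorBasis i
    rw [← WithLp.toLp_ofLp 2 (hP.1.eigenvectorBasis i), EuclideanSpace.inner_toLp_toLp,
      EuclideanSpace.inner_toLp_toLp, dotProduct_comm, dotProduct_mulVec]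
    have hv2 : ∀ y : Fin n → ℂ, star y ᵥ* (Xᴴ * X) = star ((Xᴴ * X) *ᵥ y) := by
      intro y; rw [star_mulVec, hP.1.eq]
    rw [hv2, hv, star_smul, smul_dotProduct, dotProduct_comm]
    simp
  apply Complex.ofReal_injective
  rw [h1, ← hP.1.eigenvectorBasis.sum_inner_mul_inner]
  push_cast
  refine Finset.sum_congr rfl fun i _ => ?_
  rw [h2, ← inner_conj_symm (WithLp.toLp 2 x), mul_left_comm, Complex.conj_mul']

lemma norm_eq (u : OrthonormalBasis (Fin n) ℂ (EuclideanSpace ℂ (Fin n)))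
    (x : EuclideanSpace ℂ (Fin n)) : ‖x‖ ^ 2 = ∑ i, ‖inner ℂ (u i) x‖ ^ 2 :=
  (u.sum_sq_norm_inner_right x).symm

lemma re_le (A : Matrix (Fin n) (Fin n) ℂ) (x : Fin n → ℂ) :
    (q A x x).re ≤ ‖WithLp.toLp 2 x‖ * ‖WithLp.toLp 2 (A *ᵥ x)‖ := by
  have : q A x x = inner ℂ (WithLp.toLp 2 x) (WithLp.toLp 2 (A *ᵥ x)) := by
    rw [EuclideanSpace.inner_toLp_toLp, dotProduct_comm, q]
  rw [this]
  exact (Complex.re_le_norm _).trans (norm_inner_le_norm _ _)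

lemma exists_common (u w : OrthonormalBasis (Fin n) ℂ (EuclideanSpace ℂ (Fin n)))
    (H : Matrix (Fin n) (Fin n) ℂ) (j : Fin n) :
    ∃ z : Fin n → ℂ, z ≠ 0 ∧ (∀ i, j < i → inner ℂ (u i) (WithLp.toLp 2 z) = 0) ∧
      (∀ i, i < j → inner ℂ (w i) (WithLp.toLp 2 (H *ᵥ z)) = 0) := by
  let L : (Fin n → ℂ) →ₗ[ℂ] (Fin n → ℂ) := 
    { toFun := fun z i => if j < i then inner ℂ (u i) (WithLp.toLp 2 z)
        else if i < j then inner ℂ (w i) (WithLp.toLp 2 (H *ᵥ z)) else 0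
      map_add' := by
        intro a b; ext i
        simp only [mulVec_add, WithLp.toLp_add, inner_add_right, Pi.add_apply]
        split_ifs <;> simp
      map_smul' := by
        intro c b; ext i
        simp only [mulVec_smul, WithLp.toLp_smul, inner_smul_right, Pi.smul_apply]
        split_ifs <;> simp }
  have hL : ¬ Function.Injective L := by
    intro h
    obtain ⟨z, hz⟩ := (LinearMap.injective_iff_surjective.1 h) (Pi.single j 1)
    have := congrFun hz j
    simp [L] at this
  rw [injective_iff_map_eq_zero] at hL
  push Not at hL
  obtain ⟨z, hz, hz0⟩ := hL
  refine ⟨z, hz0, fun i hi => ?_, fun i hi => ?_⟩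
  · have := congrFun hz i
    simpa [L, hi] using this
  · have := congrFun hz i
    simpa [L, hi, hi.le, not_lt_of_gt hi] using this

lemma sval_le {c : ℝ} (hc : 0 < c) {M N : Matrix (Fin n) (Fin n) ℂ}
    (h : ∀ x : Fin n → ℂ, x ≠ 0 → 0 < (q M x x).re ∧
      c * (‖WithLp.toLp 2 x‖ ^ 2) ^ 2 ≤ (q M x x).re * (q N x x).re) (j : Fin n) :
    c * sval N⁻¹ j ≤ sval M j := by
  have npos : ∀ x : Fin n → ℂ, x ≠ 0 → 0 < ‖WithLp.toLp 2 x‖ := by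
    intro x hx
    rw [norm_pos_iff]; intro h; apply hx
    simpa using h
  have hu : IsUnit N := by
    rw [← mulVec_injective_iff_isUnit]
    refine (injective_iff_map_eq_zero (Matrix.mulVecLin N)).2 fun y hy => ?_
    by_contra h0
    have h2 := (h y h0).2
    have hy' : N *ᵥ y = 0 := hy
    have := npos y h0
    have : 0 < c * (‖WithLp.toLp 2 y‖ ^ 2) ^ 2 := by positivity
    rw [show q N y y = 0 by simp [q, hy']] at h2
    simp at h2
    linarith
  have hdet := (Matrix.isUnit_iff_isUnit_det N).1 hu
  obtain ⟨u, hu⟩ := svd N⁻¹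
  obtain ⟨w, hw⟩ := svd M
  obtain ⟨z, hz0, hz1, hz2⟩ := exists_common u w N⁻¹ j
  set x := N⁻¹ *ᵥ z with hx
  have hNx : N *ᵥ x = z := by rw [hx, mulVec_mulVec, mul_nonsing_inv _ hdet, one_mulVec]
  have hx0 : x ≠ 0 := by
    intro h; rw [h] at hNx; simp at hNx; exact hz0 hNx.symm
  have b1 : sval N⁻¹ j * ‖WithLp.toLp 2 z‖ ≤ ‖WithLp.toLp 2 x‖ := by
    refine le_of_sq_le_sq ?_ (norm_nonneg _)
    rw [mul_pow, hx, hu, norm_eq u, Finset.mul_sum]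
    refine Finset.sum_le_sum fun i _ => ?_
    rcases lt_or_ge j i with hi | hi
    · simp [hz1 i hi]
    · have := sval_anti N⁻¹ hi
      have := sval_nonneg N⁻¹ j
      gcongr
  have b2 : ‖WithLp.toLp 2 (M *ᵥ x)‖ ≤ sval M j * ‖WithLp.toLp 2 x‖ := by
    refine le_of_sq_le_sq ?_ (mul_nonneg (sval_nonneg _ _) (norm_nonneg _))
    rw [mul_pow, hw, norm_eq w, Finset.mul_sum]
    refine Finset.sum_le_sum fun i _ => ?_
    rcases lt_or_ge i j with hi | hi
    · simp [hz2 i hi]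
    · have := sval_anti M hi
      have := sval_nonneg M i
      gcongr
  obtain ⟨hM, hMN⟩ := h x hx0
  have r1 := re_le M x
  have r2 := re_le N x
  rw [hNx] at r2
  have X := npos x hx0
  have Z := npos z hz0
  have S := sval_nonneg N⁻¹ j
  have T := sval_nonneg M j
  set X' := ‖WithLp.toLp 2 x‖
  set Z' := ‖WithLp.toLp 2 z‖
  set σ := sval N⁻¹ j
  set τ := sval M j
  have r3 : (q M x x).re ≤ X' * (τ * X') := r1.trans (by gcongr)
  have r4 : c * (X' ^ 2) ^ 2 ≤ (X' * (τ * X')) * (X' * Z') :=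
    hMN.trans ((mul_le_mul_of_nonneg_left r2 hM.le).trans (by gcongr))
  have r5 : (c * σ) * X' ^ 4 ≤ τ * X' ^ 4 := by
    calc (c * σ) * X' ^ 4 = σ * (c * (X' ^ 2) ^ 2) := by ring
      _ ≤ σ * ((X' * (τ * X')) * (X' * Z')) := by gcongr
      _ = τ * X' ^ 3 * (σ * Z') := by ring
      _ ≤ τ * X' ^ 3 * X' := by gcongr
      _ = _ := by ring
  exact le_of_mul_le_mul_right r5 (by positivity)

end Aux19

/-- For sector matrices `A, B` of angle `α ∈ [0, π/2)`, `v ∈ [0,1]`, and `1 ≤ k ≤ n`,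
`∏_{j=1}^k s_j(((1-v)A⁻¹ + vB⁻¹)⁻¹) ≤ sec^{4k}(α) ∏_{j=1}^k s_j((1-v)A + vB)`. -/
theorem stmt19 {n : ℕ} {α : ℝ} (hα : α ∈ Set.Ico 0 (Real.pi / 2))
    {A B : Matrix (Fin n) (Fin n) ℂ} (hA : InSector α A) (hB : InSector α B)
    {v : ℝ} (hv : v ∈ Set.Icc (0 : ℝ) 1)
    {k : ℕ} (hk1 : 1 ≤ k) (hkn : k ≤ n) :
    ∏ j ∈ Finset.univ.filter (fun j : Fin n => (j : ℕ) < k),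
        sval ((1 - v) • A⁻¹ + v • B⁻¹)⁻¹ j ≤
      (Real.cos α)⁻¹ ^ (4 * k) *
        ∏ j ∈ Finset.univ.filter (fun j : Fin n => (j : ℕ) < k),
          sval ((1 - v) • A + v • B) j := by
  have hc : 0 < Real.cos α := Real.cos_pos_of_mem_Ioo ⟨by linarith [hα.1, Real.pi_pos], hα.2⟩
  have hcard : (Finset.univ.filter (fun j : Fin n => (j : ℕ) < k)).card = k := by
    rw [Fin.card_filter_val_lt]; omega
  have e : (Real.cos α)⁻¹ ^ (4 * k) =
      ∏ j ∈ Finset.univ.filter (fun j : Fin n => (j : ℕ) < k), (Real.cos α)⁻¹ ^ 4 := by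
    rw [Finset.prod_const, hcard, pow_mul]
  rw [e, ← Finset.prod_mul_distrib]
  refine Finset.prod_le_prod (fun j _ => Aux19.sval_nonneg _ _) fun j _ => ?_
  have h := Aux19.sval_le (c := Real.cos α ^ 2) (by positivity)
    (fun x hx => Aux19.key3 hα hA hB hv x hx) j
  have hM := Aux19.sval_nonneg ((1 - v) • A + v • B) j
  have h1 : 1 ≤ (Real.cos α)⁻¹ := (one_le_inv₀ hc).2 (Real.cos_le_one α)
  calc sval ((1 - v) • A⁻¹ + v • B⁻¹)⁻¹ j
      = (Real.cos α)⁻¹ ^ 2 * (Real.cos α ^ 2 * sval ((1 - v) • A⁻¹ + v • B⁻¹)⁻¹ j) := by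
        field_simp
    _ ≤ (Real.cos α)⁻¹ ^ 2 * sval ((1 - v) • A + v • B) j := by gcongr
    _ ≤ (Real.cos α)⁻¹ ^ 4 * sval ((1 - v) • A + v • B) j := by
        gcongr
        norm_num
end
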